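/- arXiv:2510.24621 — 4 statements merged into one kernel-verified Lean document; each statement's English description precedes it below -/
import Mathlib

section
/- Let S be a finite set of points in Euclidean space ℝ^d with weights w : S → ℝ_{>0}, let c ∈ ℝ^d, and let t be a real number with 0 ≤ t ≤ Σ_{p∈S} w(p). Then there exists a function w' : S → ℝ with 0 ≤ w'(p) ≤ w(p) for all p and Σ_{p∈S} w'(p) = t that minimizes Σ_{p∈S} w'(p)·‖p − c‖ over all such functions, and that in addition satisfies: at most one point v ∈ S has 0 < w'(v) < w(v), and whenever such a point v exists, every p ∈ S with w'(p) = w(p) satisfies ‖p − c‖ ≤ ‖v − c‖. -/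
open Finset

/-- Greedy allocation: any feasible total mass `t` can be allocated so that at most one point has
partial weight, together with a threshold `r` separating points that receive weight from points
that are not fully kept. -/
theorem exists_threshold_allocation {α : Type*} (f w : α → ℝ) (S : Finset α)
    (hw : ∀ p ∈ S, 0 ≤ w p) (t : ℝ) (ht0 : 0 ≤ t) (ht1 : t ≤ ∑ p ∈ S, w p) :
    ∃ (w' : α → ℝ) (r : ℝ),
      (∀ p ∈ S, 0 ≤ w' p ∧ w' p ≤ w p) ∧
      (∑ p ∈ S, w' p) = t ∧
      (∀ u ∈ S, ∀ v ∈ S,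
        (0 < w' u ∧ w' u < w u) → (0 < w' v ∧ w' v < w v) → u = v) ∧
      (∀ p ∈ S, 0 < w' p → f p ≤ r) ∧
      (∀ p ∈ S, w' p < w p → r ≤ f p) := by
  classical
  induction S using Finset.induction_on_max_value f with
  | empty => exact ⟨0, 0, by simp, by simpa using le_antisymm ht0 (by simpa using ht1),
      by simp, by simp, by simp⟩
  | insert a s ha hmax ih =>
    simp only [Finset.forall_mem_insert] at hw ⊢
    rw [Finset.sum_insert ha] at ht1
    have hne : ∀ p ∈ s, p ≠ a := fun p hp h => ha (h ▸ hp)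
    rcases le_or_gt t (∑ p ∈ s, w p) with h | h
    · obtain ⟨w', r, hb, hsum, huniq, hpos, hlt⟩ := ih hw.2 h
      have heq : ∀ p ∈ s, Function.update w' a 0 p = w' p := fun p hp =>
        Function.update_of_ne (hne p hp) _ _
      refine ⟨Function.update w' a 0, min r (f a), ⟨by simpa using hw.1, ?_⟩, ?_,
        ⟨by simp, fun u hu => ⟨by simp, ?_⟩⟩, ⟨by simp, ?_⟩, ⟨by simp, ?_⟩⟩
      · intro p hp
        simpa only [heq p hp] using hb p hp
      · rw [Finset.sum_insert ha, Finset.sum_congr rfl heq, hsum]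
        simp
      · intro v hv
        simpa only [heq u hu, heq v hv] using huniq u hu v hv
      · intro p hp h0
        exact le_min (hpos p hp (by rwa [heq p hp] at h0)) (hmax p hp)
      · intro p hp h0
        exact min_le_of_left_le (hlt p hp (by rwa [heq p hp] at h0))
    · have heq : ∀ p ∈ s, Function.update w a (t - ∑ p ∈ s, w p) p = w p := fun p hp =>
        Function.update_of_ne (hne p hp) _ _
      refine ⟨Function.update w a (t - ∑ p ∈ s, w p), f a, ⟨?_, ?_⟩, ?_,
        ⟨⟨by simp, ?_⟩, fun u hu => ⟨?_, ?_⟩⟩, ⟨by simp, fun p hp _ => hmax p hp⟩,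
        ⟨by simp, ?_⟩⟩
      · rw [Function.update_self]
        constructor <;> linarith
      · intro p hp
        simpa only [heq p hp] using ⟨hw.2 p hp, le_rfl⟩
      · rw [Finset.sum_insert ha, Finset.sum_congr rfl heq, Function.update_self]
        ring
      · intro v hv _ h0
        exact absurd (heq v hv) h0.2.ne
      · intro h0
        exact absurd (heq u hu) h0.2.ne
      · intro v _ h0
        exact absurd (heq u hu) h0.2.ne
      · intro p hp h0
        exact absurd (heq p hp) h0.ne

/-- A threshold allocation has minimal cost among all allocations of the same total mass. -/
theorem sum_mul_le_of_threshold {α : Type*} {f w w' w'' : α → ℝ} {S : Finset α} {r : ℝ}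
    (hb' : ∀ p ∈ S, 0 ≤ w' p ∧ w' p ≤ w p) (hb'' : ∀ p ∈ S, 0 ≤ w'' p ∧ w'' p ≤ w p)
    (hsum : ∑ p ∈ S, w' p = ∑ p ∈ S, w'' p)
    (hpos : ∀ p ∈ S, 0 < w' p → f p ≤ r) (hlt : ∀ p ∈ S, w' p < w p → r ≤ f p) :
    ∑ p ∈ S, w' p * f p ≤ ∑ p ∈ S, w'' p * f p := by
  have key : ∀ p ∈ S, w' p * (f p - r) ≤ w'' p * (f p - r) := by
    intro p hp
    rcases le_total (f p) r with h | h
    · rcases (hb' p hp).2.lt_or_eq with h' | h'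
      · simp [le_antisymm h (hlt p hp h')]
      · exact mul_le_mul_of_nonpos_right (h' ▸ (hb'' p hp).2) (sub_nonpos.2 h)
    · rcases (hb' p hp).1.lt_or_eq with h' | h'
      · simp [le_antisymm h (hpos p hp h')]
      · exact mul_le_mul_of_nonneg_right (h' ▸ (hb'' p hp).1) (sub_nonneg.2 h)
  have hle := Finset.sum_le_sum key
  simp only [mul_sub, Finset.sum_sub_distrib, ← Finset.sum_mul, hsum] at hle
  linarith

/-- **Existence of a structured minimizer with at most one partial-weight point
(Claim `partial weight`).** For a finite weighted set `(S, w)` in `ℝ^d`, a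
center `c`, and a target mass `0 ≤ t ≤ Σ w`, there is a weight assignment
`0 ≤ w' ≤ w` of total mass `t` minimizing `Σ w'(p)·‖p - c‖` such that at most
one point of `S` has partial weight (`0 < w'(v) < w(v)`), and whenever such a
point `v` exists, every fully kept point `p` (with `w'(p) = w(p)`) satisfies
`‖p - c‖ ≤ ‖v - c‖`. -/
theorem structured_minimizer_partial_weight
    (d : ℕ) (S : Finset (EuclideanSpace ℝ (Fin d)))
    (w : EuclideanSpace ℝ (Fin d) → ℝ) (hw : ∀ p ∈ S, 0 < w p)
    (c : EuclideanSpace ℝ (Fin d))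
    (t : ℝ) (ht0 : 0 ≤ t) (ht1 : t ≤ ∑ p ∈ S, w p) :
    ∃ w' : EuclideanSpace ℝ (Fin d) → ℝ,
      (∀ p ∈ S, 0 ≤ w' p ∧ w' p ≤ w p) ∧
      (∑ p ∈ S, w' p) = t ∧
      (∀ w'' : EuclideanSpace ℝ (Fin d) → ℝ,
        (∀ p ∈ S, 0 ≤ w'' p ∧ w'' p ≤ w p) →
        (∑ p ∈ S, w'' p) = t →
        (∑ p ∈ S, w' p * dist p c) ≤ ∑ p ∈ S, w'' p * dist p c) ∧
      (∀ u ∈ S, ∀ v ∈ S,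
        (0 < w' u ∧ w' u < w u) → (0 < w' v ∧ w' v < w v) → u = v) ∧
      (∀ v ∈ S, (0 < w' v ∧ w' v < w v) →
        ∀ p ∈ S, w' p = w p → dist p c ≤ dist v c) := by
  obtain ⟨w', r, hb, hsum, huniq, hpos, hlt⟩ :=
    exists_threshold_allocation (dist · c) w S (fun p hp => (hw p hp).le) t ht0 ht1
  refine ⟨w', hb, hsum, fun w'' hb'' hsum'' => ?_, huniq, fun v hv hv' p hp hpw => ?_⟩
  · exact sum_mul_le_of_threshold hb hb'' (hsum.trans hsum''.symm) hpos hlt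
  · exact (hpos p hp (hpw ▸ hw p hp)).trans (hlt v hv hv'.2)
end

section
/- For every real α ≥ 1 there is a constant C = C(α) > 0 (one may take C = 24(α + 2)) with the following property. Let P be a finite set of n points in Euclidean space ℝ^d with n ≥ 4m and m ≥ 1, let c* ∈ ℝ^d satisfy cost^(m)(P,c*) ≤ α·cost^(m)(P,c) for all c ∈ ℝ^d, let L^* ⊆ P with |L^*| = m attain cost^(m)(P,c*) and set P_I^* := P ∖ L^*, and let S_O ⊆ L^* be nonempty with uniform weights w(p) := m/|S_O|. Let ε ∈ (0,1) with ε·m ≥ 1 and suppose that for every c ∈ ℝ^d and every u > 0, | |L^* ∩ Ball(c,u)| − (m/|S_O|)·|S_O ∩ Ball(c,u)| | ≤ ε·m. Then for every center c ∈ ℝ^d, |cost^(m)(P,c) − cost^(m)(S_O ∪ P_I^*, c)| ≤ C·ε·cost^(m)(P,c), where cost^(m)(S_O ∪ P_I^*, c) is the weighted robust cost with weights w on S_O and weight 1 on each point of P_I^*. -/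
open Finset
open scoped Classical

/-- Robust cost with `m` outliers of a center `c` for a finite set `P ⊂ ℝ^d`. -/
noncomputable def rcostE {d : ℕ} (m : ℕ) (P : Finset (EuclideanSpace ℝ (Fin d)))
    (c : EuclideanSpace ℝ (Fin d)) : ℝ :=
  sInf {y : ℝ | ∃ L : Finset (EuclideanSpace ℝ (Fin d)),
    L ⊆ P ∧ L.card = m ∧ y = ∑ p ∈ P \ L, dist p c}

/-- Weighted robust cost of a weighted finite set `(S, w) ⊂ ℝ^d` at target total
inlier weight `t`. -/
noncomputable def wrcostE {d : ℕ} (t : ℝ) (S : Finset (EuclideanSpace ℝ (Fin d)))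
    (w : EuclideanSpace ℝ (Fin d) → ℝ) (c : EuclideanSpace ℝ (Fin d)) : ℝ :=
  sInf {y : ℝ | ∃ w' : EuclideanSpace ℝ (Fin d) → ℝ,
    (∀ p ∈ S, 0 ≤ w' p ∧ w' p ≤ w p) ∧
    (∑ p ∈ S, w' p) = t ∧ y = ∑ p ∈ S, w' p * dist p c}

/-- A finite weighted family of reals of total weight at least `T > 0` has a `T`-quantile, and it
is bounded by any bound below which weight `T` is already present. -/
lemma exists_weighted_quantile {ι : Type*} (S : Finset ι) (w x : ι → ℝ) {T b : ℝ} (hT : 0 < T)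
    (hb : T ≤ ∑ p ∈ S with x p ≤ b, w p) :
    ∃ t ≤ b, ∑ p ∈ S with x p < t, w p < T ∧ T ≤ ∑ p ∈ S with x p ≤ t, w p := by
  have key : ∀ u : ℝ, T ≤ ∑ p ∈ S with x p ≤ u, w p →
      ∃ q ∈ S, x q ≤ u ∧ T ≤ ∑ p ∈ S with x p ≤ x q, w p := by
    intro u hu
    have hne : (S.filter (fun p => x p ≤ u)).Nonempty := by
      rw [Finset.nonempty_iff_ne_empty]
      intro h
      rw [h, Finset.sum_empty] at hu
      linarith
    obtain ⟨q, hq, hmax⟩ := Finset.exists_max_image _ x hne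
    have hq' := Finset.mem_filter.1 hq
    refine ⟨q, hq'.1, hq'.2, ?_⟩
    rwa [Finset.filter_congr (q := fun p => x p ≤ u)]
    exact fun p hp => ⟨fun h => h.trans hq'.2, fun h => hmax p (Finset.mem_filter.2 ⟨hp, h⟩)⟩
  obtain ⟨q₀, hq₀, hq₀b, hq₀T⟩ := key b hb
  obtain ⟨q, hq, hmin⟩ := Finset.exists_min_image
    (S.filter (fun q => T ≤ ∑ p ∈ S with x p ≤ x q, w p)) x ⟨q₀, Finset.mem_filter.2 ⟨hq₀, hq₀T⟩⟩
  refine ⟨x q, (hmin q₀ (Finset.mem_filter.2 ⟨hq₀, hq₀T⟩)).trans hq₀b, ?_,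
    (Finset.mem_filter.1 hq).2⟩
  by_contra! hcon
  have hne : (S.filter (fun p => x p < x q)).Nonempty := by
    rw [Finset.nonempty_iff_ne_empty]
    intro h
    rw [h, Finset.sum_empty] at hcon
    linarith
  obtain ⟨r, hr, hmax⟩ := Finset.exists_max_image _ x hne
  have hr' := Finset.mem_filter.1 hr
  refine absurd (hmin r (Finset.mem_filter.2 ⟨hr'.1, ?_⟩)) (not_le.2 hr'.2)
  rwa [Finset.filter_congr (q := fun p => x p < x q)]
  exact fun p hp => ⟨fun h => h.trans_lt hr'.2, fun h => hmax p (Finset.mem_filter.2 ⟨hp, h⟩)⟩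

/-- Weak duality for the fractional selection problem. -/
lemma dual_le_sum_mul {ι : Type*} (S : Finset ι) (w w' x : ι → ℝ) (t : ℝ)
    (h : ∀ p ∈ S, 0 ≤ w' p ∧ w' p ≤ w p) :
    t * ∑ p ∈ S, w' p - ∑ p ∈ S, w p * max (t - x p) 0 ≤ ∑ p ∈ S, w' p * x p := by
  rw [Finset.mul_sum, ← Finset.sum_sub_distrib]
  refine Finset.sum_le_sum fun p hp => ?_
  obtain ⟨h0, h1⟩ := h p hp
  have h2 := mul_le_mul_of_nonneg_right h1 (le_max_right (t - x p) 0)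
  have h3 := mul_le_mul_of_nonneg_left (le_max_left (t - x p) 0) h0
  nlinarith

/-- Complementary slackness for the fractional selection problem. -/
lemma sum_mul_eq_dual {ι : Type*} (S : Finset ι) (w w' x : ι → ℝ) (t : ℝ)
    (hlt : ∀ p ∈ S, x p < t → w' p = w p) (hgt : ∀ p ∈ S, t < x p → w' p = 0) :
    ∑ p ∈ S, w' p * x p = t * ∑ p ∈ S, w' p - ∑ p ∈ S, w p * max (t - x p) 0 := by
  rw [Finset.mul_sum, ← Finset.sum_sub_distrib]
  refine Finset.sum_congr rfl fun p hp => ?_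
  rcases lt_trichotomy (x p) t with h | h | h
  · rw [hlt p hp h, max_eq_left (by linarith)]; ring
  · rw [h]; simp [mul_comm]
  · rw [hgt p hp h, max_eq_right (by linarith)]; ring

lemma dual_le_sum_sdiff {ι : Type*} [DecidableEq ι] {P L : Finset ι} (hL : L ⊆ P) (x : ι → ℝ) (t : ℝ) :
    t * ((P.card : ℝ) - L.card) - ∑ p ∈ P, max (t - x p) 0 ≤ ∑ p ∈ P \ L, x p := by
  have h := dual_le_sum_mul (P \ L) (fun _ => 1) (fun _ => 1) x t (by simp)
  have h2 : ∑ p ∈ P \ L, max (t - x p) 0 ≤ ∑ p ∈ P, max (t - x p) 0 :=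
    Finset.sum_le_sum_of_subset_of_nonneg Finset.sdiff_subset fun _ _ _ => le_max_right _ _
  simp only [one_mul, Finset.sum_const, nsmul_eq_mul, mul_one, Finset.cast_card_sdiff hL] at h
  linarith

section

variable {d : ℕ}

lemma bddBelow_rcostE (m : ℕ) (P : Finset (EuclideanSpace ℝ (Fin d)))
    (c : EuclideanSpace ℝ (Fin d)) :
    BddBelow {y : ℝ | ∃ L : Finset (EuclideanSpace ℝ (Fin d)),
      L ⊆ P ∧ L.card = m ∧ y = ∑ p ∈ P \ L, dist p c} := by
  refine ⟨0, ?_⟩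
  rintro y ⟨L, -, -, rfl⟩
  exact Finset.sum_nonneg fun _ _ => dist_nonneg

lemma rcostE_le {m : ℕ} {P L : Finset (EuclideanSpace ℝ (Fin d))} (hL : L ⊆ P)
    (hm : L.card = m) (c : EuclideanSpace ℝ (Fin d)) :
    rcostE m P c ≤ ∑ p ∈ P \ L, dist p c :=
  csInf_le (bddBelow_rcostE m P c) ⟨L, hL, hm, rfl⟩

lemma le_rcostE {m : ℕ} {P : Finset (EuclideanSpace ℝ (Fin d))} (hm : m ≤ P.card)
    {c : EuclideanSpace ℝ (Fin d)} {y : ℝ}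
    (h : ∀ L ⊆ P, L.card = m → y ≤ ∑ p ∈ P \ L, dist p c) : y ≤ rcostE m P c := by
  obtain ⟨L, hL, hLm⟩ := Finset.exists_subset_card_eq hm
  refine le_csInf ⟨_, L, hL, hLm, rfl⟩ ?_
  rintro y ⟨L, hL, hLm, rfl⟩
  exact h L hL hLm

lemma dual_le_rcostE {m : ℕ} {P : Finset (EuclideanSpace ℝ (Fin d))} (hm : m ≤ P.card)
    (c : EuclideanSpace ℝ (Fin d)) (t : ℝ) :
    t * ((P.card : ℝ) - m) - ∑ p ∈ P, max (t - dist p c) 0 ≤ rcostE m P c := by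
  refine le_rcostE hm fun L hL hLm => ?_
  rw [← hLm]
  exact dual_le_sum_sdiff hL _ t

lemma exists_rcostE_le_dual {m : ℕ} {P : Finset (EuclideanSpace ℝ (Fin d))} (hm : m < P.card)
    (c : EuclideanSpace ℝ (Fin d)) {b : ℝ}
    (hb : (P.card : ℝ) - m ≤ ∑ p ∈ P with dist p c ≤ b, (1 : ℝ)) :
    ∃ t ≤ b, rcostE m P c ≤ t * ((P.card : ℝ) - m) - ∑ p ∈ P, max (t - dist p c) 0 := by
  have hpos : (0 : ℝ) < (P.card : ℝ) - m := sub_pos.2 (by exact_mod_cast hm)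
  obtain ⟨t, htb, h1, h2⟩ := exists_weighted_quantile P (fun _ => 1) (fun p => dist p c) hpos hb
  simp only [Finset.sum_const, nsmul_eq_mul, mul_one] at h1 h2
  rw [← Nat.cast_sub hm.le, Nat.cast_lt] at h1
  rw [← Nat.cast_sub hm.le, Nat.cast_le] at h2
  obtain ⟨K, hK1, hK2, hK⟩ := Finset.exists_subsuperset_card_eq
    (s := P.filter (fun p => dist p c < t)) (t := P.filter (fun p => dist p c ≤ t))
    (Finset.monotone_filter_right _ fun _ _ h => le_of_lt h) h1.le h2
  have hKP : K ⊆ P := hK2.trans (Finset.filter_subset _ _)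
  refine ⟨t, htb, ?_⟩
  have hcost := rcostE_le (m := m) (L := P \ K) Finset.sdiff_subset
    (by rw [Finset.card_sdiff_of_subset hKP, hK]; omega) c
  rw [Finset.sdiff_sdiff_eq_self hKP] at hcost
  refine hcost.trans (le_of_eq ?_)
  have h := sum_mul_eq_dual P (fun _ => 1) (fun p => if p ∈ K then 1 else 0)
    (fun p => dist p c) t
    (fun p hp h => if_pos (hK1 (Finset.mem_filter.2 ⟨hp, h⟩)))
    (fun p hp h => if_neg fun hpK => absurd (Finset.mem_filter.1 (hK2 hpK)).2 (not_le.2 h))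
  simp only [ite_mul, one_mul, zero_mul, Finset.sum_ite_mem,
    Finset.inter_eq_right.2 hKP, Finset.sum_const, nsmul_eq_mul, mul_one, hK] at h
  rw [h, Nat.cast_sub hm.le]

lemma dual_le_wrcostE {T : ℝ} {S : Finset (EuclideanSpace ℝ (Fin d))}
    {w : EuclideanSpace ℝ (Fin d) → ℝ} (hw : ∀ p ∈ S, 0 ≤ w p) (hT : 0 ≤ T)
    (hS : T ≤ ∑ p ∈ S, w p) (c : EuclideanSpace ℝ (Fin d)) (t : ℝ) :
    t * T - ∑ p ∈ S, w p * max (t - dist p c) 0 ≤ wrcostE T S w c := by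
  refine le_csInf ?_ ?_
  · have hW : 0 ≤ ∑ p ∈ S, w p := hT.trans hS
    refine ⟨_, fun p => T / (∑ p ∈ S, w p) * w p, fun p hp => ⟨?_, ?_⟩, ?_, rfl⟩
    · exact mul_nonneg (div_nonneg hT hW) (hw p hp)
    · exact mul_le_of_le_one_left (hw p hp) (div_le_one_of_le₀ hS hW)
    · rw [← Finset.mul_sum]
      rcases hW.eq_or_lt with h | h
      · rw [← h] at hS ⊢
        simp [le_antisymm hT hS]
      · exact div_mul_cancel₀ _ h.ne'
  · rintro y ⟨w', hw', rfl, rfl⟩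
    exact dual_le_sum_mul S w w' _ t hw'

lemma exists_wrcostE_le_dual {T : ℝ} {S : Finset (EuclideanSpace ℝ (Fin d))}
    {w : EuclideanSpace ℝ (Fin d) → ℝ} (hw : ∀ p ∈ S, 0 ≤ w p) (hT : 0 < T)
    (c : EuclideanSpace ℝ (Fin d)) {b : ℝ} (hb : T ≤ ∑ p ∈ S with dist p c ≤ b, w p) :
    ∃ t ≤ b, wrcostE T S w c ≤ t * T - ∑ p ∈ S, w p * max (t - dist p c) 0 := by
  obtain ⟨t, htb, h1, h2⟩ := exists_weighted_quantile S w (fun p => dist p c) hT hb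
  refine ⟨t, htb, ?_⟩
  set A := ∑ p ∈ S with dist p c < t, w p with hA
  set B := ∑ p ∈ S with dist p c = t, w p with hB
  have hAB : ∑ p ∈ S with dist p c ≤ t, w p = A + B := by
    simp only [hA, hB, Finset.sum_filter, ← Finset.sum_add_distrib]
    refine Finset.sum_congr rfl fun p _ => ?_
    rcases lt_trichotomy (dist p c) t with h | h | h
    · simp [h, h.le, h.ne]
    · simp [h]
    · simp [h.not_ge, h.not_gt, h.ne']
  rw [hAB] at h2
  have hBpos : 0 < B := by linarith
  have hr0 : 0 ≤ (T - A) / B := div_nonneg (by linarith) hBpos.le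
  have hr1 : (T - A) / B ≤ 1 := (div_le_one hBpos).2 (by linarith)
  let w' : EuclideanSpace ℝ (Fin d) → ℝ := fun p =>
    (if dist p c < t then w p else 0) + (T - A) / B * (if dist p c = t then w p else 0)
  have hsum : ∑ p ∈ S, w' p = T := by
    simp only [w', Finset.sum_add_distrib, ← Finset.mul_sum, ← Finset.sum_filter, ← hA, ← hB]
    rw [div_mul_cancel₀ _ hBpos.ne']
    ring
  have hdual := sum_mul_eq_dual S w w' (fun p => dist p c) t
    (fun p _ h => by simp only [w', if_pos h, if_neg h.ne]; ring)
    (fun p _ h => by simp only [w', if_neg h.not_gt, if_neg h.ne']; ring)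
  rw [hsum] at hdual
  rw [← hdual]
  refine csInf_le ⟨t * T - ∑ p ∈ S, w p * max (t - dist p c) 0, ?_⟩ ⟨w', fun p hp => ?_, hsum, rfl⟩
  · rintro y ⟨v, hv, rfl, rfl⟩
    exact dual_le_sum_mul S w v _ t hv
  · have := hw p hp
    rcases lt_trichotomy (dist p c) t with h | h | h
    · simp [w', h, h.ne, this]
    · simp only [w', h, lt_irrefl, if_false, if_true, zero_add]
      exact ⟨mul_nonneg hr0 this, mul_le_of_le_one_left this hr1⟩
    · simp [w', h.not_gt, h.ne', this]

lemma intervalIntegrable_step (x a t : ℝ) :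
    IntervalIntegrable (fun u => if x ≤ u then (1 : ℝ) else 0) MeasureTheory.volume a t := by
  refine Monotone.intervalIntegrable fun u v huv => ?_
  split_ifs with h1 h2
  · exact le_rfl
  · exact absurd (h1.trans huv) h2
  · exact zero_le_one
  · exact le_rfl

lemma integral_step {x a t : ℝ} (hax : a ≤ x) (hat : a ≤ t) :
    ∫ u in a..t, (if x ≤ u then (1 : ℝ) else 0) = max (t - x) 0 := by
  have hind : (fun u => if x ≤ u then (1 : ℝ) else 0) = (Set.Ici x).indicator 1 := by
    ext u
    simp [Set.indicator_apply]
  rw [intervalIntegral.integral_of_le hat, hind, MeasureTheory.integral_indicator_one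
    measurableSet_Ici, MeasureTheory.measureReal_restrict_apply measurableSet_Ici]
  rcases hax.eq_or_lt with rfl | h
  · rw [Set.inter_eq_right.2 (Set.Ioc_subset_Ioi_self.trans Set.Ioi_subset_Ici_self), Real.volume_real_Ioc]
  · have : Set.Ici x ∩ Set.Ioc a t = Set.Icc x t := by
      ext u
      simp only [Set.mem_inter_iff, Set.mem_Ici, Set.mem_Ioc, Set.mem_Icc]
      exact ⟨fun hu => ⟨hu.1, hu.2.2⟩, fun hu => ⟨hu.1, h.trans_le hu.1, hu.2⟩⟩
    rw [this, Real.volume_real_Icc]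

/-- Closeness of the distribution functions of two finite families gives closeness of the sums of
positive parts. -/
lemma abs_sum_max_sub_le {ι : Type*} {A B : Finset ι} {x : ι → ℝ} {a s δ : ℝ}
    (hA : ∀ p ∈ A, a ≤ x p) (hB : ∀ p ∈ B, a ≤ x p)
    (h : ∀ u, a < u → |((A.filter (fun p => x p ≤ u)).card : ℝ) -
      s * ((B.filter (fun p => x p ≤ u)).card : ℝ)| ≤ δ) (t : ℝ) :
    |∑ p ∈ A, max (t - x p) 0 - s * ∑ p ∈ B, max (t - x p) 0| ≤ δ * max (t - a) 0 := by
  rcases le_total t a with hta | hat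
  · have hz : ∀ D : Finset ι, (∀ p ∈ D, a ≤ x p) → ∑ p ∈ D, max (t - x p) 0 = 0 := fun D hD =>
      Finset.sum_eq_zero fun p hp => max_eq_right (by linarith [hD p hp])
    simp [hz A hA, hz B hB, max_eq_right (sub_nonpos.2 hta)]
  have hcard : ∀ D : Finset ι, ∀ u, ((D.filter (fun p => x p ≤ u)).card : ℝ) =
      ∑ p ∈ D, if x p ≤ u then (1 : ℝ) else 0 := fun D u => by
    simp
  have hfun : ∀ D : Finset ι, IntervalIntegrable
      (fun u => ((D.filter (fun p => x p ≤ u)).card : ℝ)) MeasureTheory.volume a t := fun D => by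
    simp only [hcard]
    simpa only [Finset.sum_fn] using
      IntervalIntegrable.sum D fun p _ => intervalIntegrable_step (x p) a t
  have hI : ∀ D : Finset ι, (∀ p ∈ D, a ≤ x p) →
      ∑ p ∈ D, max (t - x p) 0 = ∫ u in a..t, ((D.filter (fun p => x p ≤ u)).card : ℝ) := by
    intro D hD
    simp only [hcard]
    rw [intervalIntegral.integral_finsetSum fun p _ => intervalIntegrable_step _ _ _]
    exact Finset.sum_congr rfl fun p hp => (integral_step (hD p hp) hat).symm
  rw [hI A hA, hI B hB, ← intervalIntegral.integral_const_mul,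
    ← intervalIntegral.integral_sub (hfun A) ((hfun B).const_mul s), max_eq_left (sub_nonneg.2 hat)]
  rw [← Real.norm_eq_abs]
  refine (intervalIntegral.norm_integral_le_of_norm_le_const (C := δ) fun u hu => ?_).trans_eq
    (by rw [abs_of_nonneg (sub_nonneg.2 hat)])
  rw [Set.uIoc_of_le hat] at hu
  exact h u hu.1

/-- An optimal set of outliers lies farther from the center than every inlier. -/
lemma dist_le_of_sum_eq_rcostE {m : ℕ} {P L : Finset (EuclideanSpace ℝ (Fin d))} (hL : L ⊆ P)
    (hm : L.card = m) {c : EuclideanSpace ℝ (Fin d)}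
    (hopt : ∑ p ∈ P \ L, dist p c = rcostE m P c) {p q : EuclideanSpace ℝ (Fin d)}
    (hp : p ∈ P \ L) (hq : q ∈ L) : dist p c ≤ dist q c := by
  obtain ⟨hpP, hpL⟩ := Finset.mem_sdiff.1 hp
  have hpe : p ∉ L.erase q := fun h => hpL (Finset.mem_of_mem_erase h)
  have hpq : q ≠ p := fun h => hpL (h ▸ hq)
  have hsub : insert p (L.erase q) ⊆ P :=
    Finset.insert_subset hpP ((Finset.erase_subset _ _).trans hL)
  have hcost := rcostE_le (m := m) hsub
    (by rw [Finset.card_insert_of_notMem hpe, Finset.card_erase_add_one hq, hm]) c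
  have h1 := Finset.sum_sdiff (f := fun p => dist p c) hsub
  have h2 := Finset.sum_sdiff (f := fun p => dist p c) hL
  have h3 := Finset.add_sum_erase L (fun p => dist p c) hq
  rw [Finset.sum_insert hpe] at h1
  linarith

/-- Two centers far apart cannot both have small robust cost. -/
lemma mul_dist_le_add_rcostE {m : ℕ} {P L : Finset (EuclideanSpace ℝ (Fin d))} (hL : L ⊆ P)
    (hm : L.card = m) (c₀ c : EuclideanSpace ℝ (Fin d)) :
    ((P.card : ℝ) - 2 * m) * dist c c₀ ≤ ∑ p ∈ P \ L, dist p c₀ + rcostE m P c := by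
  suffices h : ((P.card : ℝ) - 2 * m) * dist c c₀ - ∑ p ∈ P \ L, dist p c₀ ≤ rcostE m P c by
    linarith
  refine le_rcostE (hm ▸ Finset.card_le_card hL) fun L' hL' hm' => ?_
  have hcard : (P.card : ℝ) - 2 * m ≤ ((P \ (L ∪ L')).card : ℝ) := by
    rw [Finset.cast_card_sdiff (Finset.union_subset hL hL')]
    have : ((L ∪ L').card : ℝ) ≤ L.card + L'.card := by exact_mod_cast Finset.card_union_le L L'
    rw [hm, hm'] at this
    linarith
  have h1 : ∑ p ∈ P \ (L ∪ L'), dist p c₀ ≤ ∑ p ∈ P \ L, dist p c₀ :=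
    Finset.sum_le_sum_of_subset_of_nonneg
      (Finset.sdiff_subset_sdiff subset_rfl Finset.subset_union_left) fun _ _ _ => dist_nonneg
  have h2 : ∑ p ∈ P \ (L ∪ L'), dist p c ≤ ∑ p ∈ P \ L', dist p c :=
    Finset.sum_le_sum_of_subset_of_nonneg
      (Finset.sdiff_subset_sdiff subset_rfl Finset.subset_union_right) fun _ _ _ => dist_nonneg
  have h3 : ((P \ (L ∪ L')).card : ℝ) * dist c c₀ ≤
      ∑ p ∈ P \ (L ∪ L'), (dist p c + dist p c₀) := by
    rw [← nsmul_eq_mul]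
    exact Finset.card_nsmul_le_sum _ _ _ fun p _ => dist_triangle_left c c₀ p
  rw [Finset.sum_add_distrib] at h3
  have h4 := mul_le_mul_of_nonneg_right hcard (dist_nonneg (x := c) (y := c₀))
  linarith

end

/-- **Induced error of `S_O` (Lemma `induced error of S_O`).**
For every `α ≥ 1` there is a constant `C = C(α) > 0` (one may take
`C = 24(α + 2)`) such that: if `n ≥ 4m`, `c*` is an `α`-approximate robust
center, `L*` attains `cost^(m)(P,c*)`, `P_I^* = P ∖ L*`, `S_O ⊆ L*` is a
nonempty uniform subsample with weights `m/|S_O|` forming an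
`ε`-ball-range-space approximation of `L*` (with `ε·m ≥ 1`, `ε ∈ (0,1)`), then
for every center `c`,
`|cost^(m)(P,c) - cost^(m)(S_O ∪ P_I^*, c)| ≤ C·ε·cost^(m)(P,c)`. -/
theorem induced_error_of_SO :
    ∀ α : ℝ, 1 ≤ α →
    ∃ C : ℝ, 0 < C ∧
      ∀ (d n m : ℕ) (P : Finset (EuclideanSpace ℝ (Fin d)))
        (cstar : EuclideanSpace ℝ (Fin d))
        (Lstar SO : Finset (EuclideanSpace ℝ (Fin d))) (ε : ℝ),
        1 ≤ m → 4 * m ≤ n → P.card = n →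
        (∀ c : EuclideanSpace ℝ (Fin d), rcostE m P cstar ≤ α * rcostE m P c) →
        Lstar ⊆ P → Lstar.card = m →
        (∑ p ∈ P \ Lstar, dist p cstar) = rcostE m P cstar →
        SO ⊆ Lstar → SO.Nonempty →
        0 < ε → ε < 1 → 1 ≤ ε * m →
        (∀ (c : EuclideanSpace ℝ (Fin d)) (u : ℝ), 0 < u →
          |(((Lstar.filter (fun p => dist p c ≤ u)).card : ℝ)) -
            ((m : ℝ) / SO.card) * ((SO.filter (fun p => dist p c ≤ u)).card : ℝ)| ≤ ε * m) →
        ∀ c : EuclideanSpace ℝ (Fin d),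
          |rcostE m P c -
              wrcostE ((n : ℝ) - m) (SO ∪ (P \ Lstar))
                (fun p => if p ∈ SO then (m : ℝ) / SO.card else 1) c| ≤
            C * ε * rcostE m P c := by
  intro α hα
  refine ⟨1 + α, by linarith, ?_⟩
  intro d n m P cstar Lstar SO ε hm hn hP happ hLP hLm hopt hSO hne hε hε1 hεm hball c
  subst hP
  have hmP : m < P.card := by omega
  have hm0 : (0 : ℝ) < m := by exact_mod_cast hm
  have hs : (0 : ℝ) < (m : ℝ) / SO.card := div_pos hm0 (by exact_mod_cast hne.card_pos)
  have hT : (0 : ℝ) < (P.card : ℝ) - m := sub_pos.2 (by exact_mod_cast hmP)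
  have hIcard : ((P \ Lstar).card : ℝ) = (P.card : ℝ) - m := by
    rw [Finset.cast_card_sdiff hLP, hLm]
  have hIne : (P \ Lstar).Nonempty := by
    rw [← Finset.card_pos]
    exact_mod_cast hIcard ▸ hT
  obtain ⟨q, hq, hqmax⟩ := Finset.exists_max_image (P \ Lstar) (fun p => dist p cstar) hIne
  set D := dist c cstar with hD
  set r := dist q cstar with hr
  set s := (m : ℝ) / SO.card
  set w : EuclideanSpace ℝ (Fin d) → ℝ := fun p => if p ∈ SO then s else 1 with hwdef
  have hdisj : Disjoint SO (P \ Lstar) :=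
    Finset.disjoint_of_subset_left hSO Finset.disjoint_sdiff
  have hw : ∀ p ∈ SO ∪ (P \ Lstar), 0 ≤ w p := fun p _ => by
    simp only [hwdef]
    split_ifs
    exacts [hs.le, zero_le_one]
  have hwI : ∀ p ∈ P \ Lstar, w p = 1 := fun p hp =>
    if_neg fun h => Finset.disjoint_left.1 hdisj h hp
  have hin : ∀ p ∈ P \ Lstar, dist p c ≤ r + D := fun p hp => by
    have h1 := hqmax p hp
    have h2 := dist_triangle_right p c cstar
    exact h2.trans (by linarith)
  have hout : ∀ p ∈ Lstar, max (r - D) 0 ≤ dist p c := fun p hp => by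
    refine max_le ?_ dist_nonneg
    have h1 := dist_le_of_sum_eq_rcostE hLP hLm hopt hq hp
    have h2 := dist_triangle p c cstar
    linarith
  have hWI : (P.card : ℝ) - m ≤ ∑ p ∈ SO ∪ (P \ Lstar) with dist p c ≤ r + D, w p := by
    calc (P.card : ℝ) - m = ∑ p ∈ P \ Lstar, w p := by
          rw [Finset.sum_congr rfl hwI, Finset.sum_const, nsmul_eq_mul, mul_one, hIcard]
      _ ≤ _ := Finset.sum_le_sum_of_subset_of_nonneg
          (fun p hp => Finset.mem_filter.2 ⟨Finset.mem_union_right _ hp, hin p hp⟩)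
          fun p hp _ => hw p (Finset.filter_subset _ _ hp)
  have hNI : (P.card : ℝ) - m ≤ ∑ p ∈ P with dist p c ≤ r + D, (1 : ℝ) := by
    calc (P.card : ℝ) - m = ∑ p ∈ P \ Lstar, (1 : ℝ) := by
          rw [Finset.sum_const, nsmul_eq_mul, mul_one, hIcard]
      _ ≤ _ := Finset.sum_le_sum_of_subset_of_nonneg
          (fun p hp => Finset.mem_filter.2 ⟨Finset.sdiff_subset hp, hin p hp⟩)
          fun _ _ _ => zero_le_one
  have hWtot : (P.card : ℝ) - m ≤ ∑ p ∈ SO ∪ (P \ Lstar), w p :=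
    hWI.trans (Finset.sum_le_sum_of_subset_of_nonneg (Finset.filter_subset _ _)
      fun p hp _ => hw p hp)
  have hdiff : ∀ t ≤ r + D,
      |∑ p ∈ P, max (t - dist p c) 0 - ∑ p ∈ SO ∪ (P \ Lstar), w p * max (t - dist p c) 0| ≤
        ε * m * (2 * D) := by
    intro t ht
    have h1 := abs_sum_max_sub_le (x := fun p => dist p c) hout (fun p hp => hout p (hSO hp))
      (fun u hu => hball c u ((le_max_right _ _).trans_lt hu)) t
    have h2 := Finset.sum_sdiff (f := fun p => max (t - dist p c) 0) hLP
    have h3 : ∑ p ∈ SO, w p * max (t - dist p c) 0 = s * ∑ p ∈ SO, max (t - dist p c) 0 := by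
      rw [Finset.mul_sum]
      exact Finset.sum_congr rfl fun p hp => by simp only [hwdef, if_pos hp]
    have h4 : ∑ p ∈ P \ Lstar, w p * max (t - dist p c) 0 =
        ∑ p ∈ P \ Lstar, max (t - dist p c) 0 :=
      Finset.sum_congr rfl fun p hp => by rw [hwI p hp, one_mul]
    rw [Finset.sum_union hdisj, h3, h4, ← h2, add_comm (∑ p ∈ P \ Lstar, _),
      add_sub_add_right_eq_sub]
    refine h1.trans (mul_le_mul_of_nonneg_left (max_le ?_ ?_) (by positivity))
    · linarith [le_max_left (r - D) 0]
    · have : 0 ≤ D := dist_nonneg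
      linarith
  have hcost : |rcostE m P c - wrcostE ((P.card : ℝ) - m) (SO ∪ (P \ Lstar)) w c| ≤
      ε * m * (2 * D) := by
    obtain ⟨t₁, ht₁, hle₁⟩ := exists_rcostE_le_dual hmP c hNI
    obtain ⟨t₂, ht₂, hle₂⟩ := exists_wrcostE_le_dual hw hT c hWI
    have hge₁ := dual_le_wrcostE hw hT.le hWtot c t₁
    have hge₂ := dual_le_rcostE hmP.le c t₂
    have hd₁ := abs_le.1 (hdiff t₁ ht₁)
    have hd₂ := abs_le.1 (hdiff t₂ ht₂)
    rw [abs_le]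
    constructor <;> linarith
  have hDle : (m : ℝ) * (2 * D) ≤ (1 + α) * rcostE m P c := by
    have h1 := mul_dist_le_add_rcostE hLP hLm cstar c
    rw [hopt] at h1
    have h2 := happ c
    have h3 : (4 : ℝ) * m ≤ P.card := by exact_mod_cast hn
    have h4 : (2 * (m : ℝ)) * D ≤ ((P.card : ℝ) - 2 * m) * D :=
      mul_le_mul_of_nonneg_right (by linarith) dist_nonneg
    linarith
  refine hcost.trans ?_
  have := mul_le_mul_of_nonneg_left hDle hε.le
  linarith
end

section
/- Let n ≥ 2 and 1 ≤ m < n be integers and ε ∈ (0,1). Define the dataset P = {p_1 < ⋯ < p_n} ⊂ ℝ by p_i := i/n for 1 ≤ i ≤ n − m and p_i := n^{3(i−n+m)} for n − m < i ≤ n. Suppose P is partitioned into nonempty consecutive buckets B_1, …, B_T (every element of B_i is less than every element of B_{i+1}) such that for every center c ∈ ℝ and every tuple of integers (m_1,…,m_T) with 0 ≤ m_i ≤ |B_i| and Σ_{i=1}^T m_i = m, one has Σ_{i=1}^T |cost^{(m_i)}(B_i,c) − (|B_i| − m_i)·|μ(B_i) − c|| ≤ ε·cost^{(m)}(P,c).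 Then every bucket that contains a point p_j with j > n − m is a singleton; in particular T ≥ m. -/
open Finset
open scoped Classical

/-- Robust cost with `m` outliers of a center `c` for a dataset `p : Fin n → ℝ`. -/
noncomputable def rcostIdx {n : ℕ} (m : ℕ) (p : Fin n → ℝ) (c : ℝ) : ℝ :=
  sInf {y : ℝ | ∃ L : Finset (Fin n), L.card = m ∧ y = ∑ i ∈ Lᶜ, |p i - c|}

/-- Robust cost with `t` outliers of a center `c` restricted to the points of
`p` indexed by the bucket `B`. -/
noncomputable def rcostBucket {n : ℕ} (t : ℕ) (B : Finset (Fin n)) (p : Fin n → ℝ)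
    (c : ℝ) : ℝ :=
  sInf {y : ℝ | ∃ L : Finset (Fin n), L ⊆ B ∧ L.card = t ∧ y = ∑ i ∈ B \ L, |p i - c|}

/-- Mean of the points of `p` indexed by a finite index set `B`. -/
noncomputable def meanIdx {n : ℕ} (p : Fin n → ℝ) (B : Finset (Fin n)) : ℝ :=
  (∑ i ∈ B, p i) / B.card

theorem rcostIdx_le {n : ℕ} {m : ℕ} (p : Fin n → ℝ) (c : ℝ) {L : Finset (Fin n)}
    (hL : L.card = m) : rcostIdx m p c ≤ ∑ i ∈ Lᶜ, |p i - c| := by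
  refine csInf_le ⟨0, ?_⟩ ⟨L, hL, rfl⟩
  rintro _ ⟨L, -, rfl⟩
  positivity

theorem rcostBucket_le {n : ℕ} {t : ℕ} {B L : Finset (Fin n)} (p : Fin n → ℝ) (c : ℝ)
    (hLB : L ⊆ B) (hL : L.card = t) : rcostBucket t B p c ≤ ∑ i ∈ B \ L, |p i - c| := by
  refine csInf_le ⟨0, ?_⟩ ⟨L, hLB, hL, rfl⟩
  rintro _ ⟨L, -, -, rfl⟩
  positivity

theorem sum_card_inter_of_partition {α ι : Type*} [DecidableEq α] [Fintype ι]
    {B : ι → Finset α} (hdisj : Pairwise fun j₁ j₂ => Disjoint (B j₁) (B j₂))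
    (hcover : ∀ a, ∃ j, a ∈ B j) (L : Finset α) : ∑ j, (B j ∩ L).card = L.card := by
  classical
  rw [← card_biUnion fun j₁ _ j₂ _ h =>
    (hdisj h).mono inter_subset_left inter_subset_left]
  congr 1
  ext a
  simpa using fun _ => hcover a

/-- If a nonempty part of total `X` is removed from a family of `s + t` numbers, the total `Y` of
the remaining `s` numbers is far below `s` times the mean, provided `X` is large. -/
theorem sub_one_le_mul_mean_sub {n s t q X Y : ℝ} (hn : 1 ≤ n) (hs : 1 ≤ s) (ht : 0 ≤ t)
    (hst : s + t ≤ n) (hq : 1 ≤ q) (hX : n ^ 3 * q ≤ X) (hY : Y ≤ s * q) :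
    n - 1 ≤ s * ((X + Y) / (s + t)) - Y := by
  have hb : 0 < s + t := by linarith
  have hsX : s * (n ^ 3 * q) ≤ s * X := mul_le_mul_of_nonneg_left hX (by linarith)
  have htY : t * Y ≤ t * (s * q) := mul_le_mul_of_nonneg_left hY ht
  have hcube : n ≤ n ^ 3 := le_self_pow₀ hn (by norm_num)
  have hsq : 1 ≤ s * q := one_le_mul_of_one_le_of_one_le hs hq
  have hgap : n ^ 3 - n ≤ s * q * (n ^ 3 - t) :=
    calc n ^ 3 - n ≤ 1 * (n ^ 3 - t) := by linarith
      _ ≤ s * q * (n ^ 3 - t) := mul_le_mul_of_nonneg_right hsq (by linarith)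
  have hfin : (n - 1) * (s + t) ≤ n ^ 3 - n :=
    calc (n - 1) * (s + t) ≤ (n - 1) * n := mul_le_mul_of_nonneg_left hst (by linarith)
      _ ≤ n ^ 3 - n := by nlinarith [mul_nonneg (sub_nonneg.2 hn) (mul_self_nonneg n)]
  have hrw : s * ((X + Y) / (s + t)) - Y = (s * X - t * Y) / (s + t) := by
    field_simp
    ring
  rw [hrw, le_div_iff₀ hb]
  linarith

/-- **Obstacle for the component-wise error analysis.**
For the dataset `p_i = i/n` (`1 ≤ i ≤ n-m`) and `p_i = n^{3(i-n+m)}`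
(`n-m < i ≤ n`), any partition into nonempty consecutive buckets `B_1, …, B_T`
satisfying the component-wise error guarantee
`Σ_i |cost^{(m_i)}(B_i, c) - (|B_i| - m_i)·|μ(B_i) - c|| ≤ ε·cost^{(m)}(P, c)`
for every center `c` and every admissible outlier distribution `(m_1,…,m_T)`
must make every bucket containing a point `p_j` with `j > n - m` a singleton;
in particular `T ≥ m`. -/
theorem component_wise_obstacle
    (n m T : ℕ) (hn : 2 ≤ n) (hm : 1 ≤ m) (hmn : m < n)
    (ε : ℝ) (hε0 : 0 < ε) (hε1 : ε < 1)
    (p : Fin n → ℝ)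
    (hp : ∀ i : Fin n, p i =
      if i.1 + 1 ≤ n - m then ((i.1 + 1 : ℕ) : ℝ) / n
      else (n : ℝ) ^ (3 * (i.1 + 1 - (n - m))))
    (Bl : Fin T → Finset (Fin n))
    (hBne : ∀ j, (Bl j).Nonempty)
    (hBord : ∀ j₁ j₂ : Fin T, j₁ < j₂ → ∀ i₁ ∈ Bl j₁, ∀ i₂ ∈ Bl j₂, i₁ < i₂)
    (hBcover : ∀ i : Fin n, ∃ j, i ∈ Bl j)
    (herr : ∀ (c : ℝ) (ms : Fin T → ℕ),
      (∀ j, ms j ≤ (Bl j).card) → (∑ j, ms j) = m →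
      (∑ j, abs (rcostBucket (ms j) (Bl j) p c -
          (((Bl j).card : ℝ) - ms j) * |meanIdx p (Bl j) - c|)) ≤
        ε * rcostIdx m p c) :
    (∀ j : Fin T, (∃ i ∈ Bl j, n - m < i.1 + 1) → (Bl j).card = 1) ∧ m ≤ T := by
  have hn1 : (1 : ℝ) ≤ n := by exact_mod_cast (by omega : 1 ≤ n)
  have hn0 : (0 : ℝ) < n := by linarith
  have hin : ∀ i : Fin n, i.1 + 1 ≤ n - m → p i ≤ 1 := by
    intro i hi
    rw [hp, if_pos hi, div_le_one hn0]
    exact_mod_cast (by omega : i.1 + 1 ≤ n)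
  have hp0 : ∀ i : Fin n, 0 ≤ p i := by
    intro i
    rw [hp]
    split_ifs <;> positivity
  have hdisj : Pairwise fun j₁ j₂ => Disjoint (Bl j₁) (Bl j₂) := by
    intro j₁ j₂ h
    rw [Finset.disjoint_left]
    intro i h₁ h₂
    rcases lt_or_gt_of_ne h with h | h
    · exact lt_irrefl _ (hBord _ _ h _ h₁ _ h₂)
    · exact lt_irrefl _ (hBord _ _ h _ h₂ _ h₁)
  have hout : (univ.filter fun i : Fin n => n - m < i.1 + 1).card = m := by
    have h : (univ.filter fun i : Fin n => n - m < i.1 + 1) = Finset.Ici ⟨n - m, by omega⟩ := by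
      ext i
      simp [Fin.le_def]
    rw [h, Fin.card_Ici]
    simp only
    omega
  have hcost : rcostIdx m p 0 ≤ n - 1 := by
    refine (rcostIdx_le p 0 hout).trans ((sum_le_card_nsmul _ _ 1 ?_).trans ?_)
    · intro i hi
      simp only [mem_compl, mem_filter, mem_univ, true_and, not_lt] at hi
      rw [sub_zero, abs_of_nonneg (hp0 i)]
      exact hin i hi
    · rw [card_compl, hout, Fintype.card_fin, nsmul_one, le_sub_iff_add_le]
      exact_mod_cast (by omega : n - m + 1 ≤ n)
  have hsingle : ∀ j : Fin T, (∃ i ∈ Bl j, n - m < i.1 + 1) → (Bl j).card = 1 := by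
    rintro j ⟨i, hij, hi⟩
    by_contra hcard
    set B := Bl j with hB
    have hBcard : 1 < B.card :=
      lt_of_le_of_ne (hBne j).card_pos (Ne.symm hcard)
    set a := B.max' (hBne j)
    have haB : a ∈ B := B.max'_mem _
    have hai : n - m < a.1 + 1 := by
      have : i.1 ≤ a.1 := Fin.le_def.1 (B.le_max' _ hij)
      omega
    obtain ⟨b, hbB, hba⟩ := exists_mem_ne hBcard a
    obtain ⟨L, haL, hLb, hLm⟩ : ∃ L : Finset (Fin n), {a} ⊆ L ∧ L ⊆ {b}ᶜ ∧ L.card = m := by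
      refine exists_subsuperset_card_eq ?_ (by simpa using hm) ?_
      · simpa using hba
      · rw [card_compl, card_singleton, Fintype.card_fin]
        omega
    have haL : a ∈ L := by simpa using haL
    have hbL : b ∉ L := fun h => by simpa using hLb h
    have hpart : (B \ L).card + (B ∩ L).card = B.card := card_sdiff_add_card_inter B L
    have hpartR : ((B \ L).card : ℝ) + ((B ∩ L).card : ℝ) = B.card := by exact_mod_cast hpart
    set q : ℝ := (n : ℝ) ^ (3 * (a.1 - (n - m))) with hq
    have hq1 : 1 ≤ q := one_le_pow₀ hn1
    have hpa : p a = n ^ 3 * q := by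
      rw [hp, if_neg (by omega), hq, ← pow_add]
      congr 1
      omega
    have hX : (n : ℝ) ^ 3 * q ≤ ∑ i ∈ B ∩ L, p i :=
      hpa ▸ single_le_sum (fun i _ => hp0 i) (mem_inter.2 ⟨haB, haL⟩)
    have hY : ∑ i ∈ B \ L, p i ≤ (B \ L).card * q := by
      rw [← nsmul_eq_mul]
      refine sum_le_card_nsmul _ _ _ fun i hi => ?_
      obtain ⟨hiB, hiL⟩ := mem_sdiff.1 hi
      have hia : i < a := lt_of_le_of_ne (B.le_max' _ hiB) fun h => hiL (h ▸ haL)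
      by_cases hi : i.1 + 1 ≤ n - m
      · exact (hin i hi).trans hq1
      · rw [hp, if_neg hi]
        have := Fin.lt_def.1 hia
        exact pow_le_pow_right₀ hn1 (by omega)
    have hgap := sub_one_le_mul_mean_sub hn1
      (by exact_mod_cast card_pos.2 ⟨b, mem_sdiff.2 ⟨hbB, hbL⟩⟩ : (1 : ℝ) ≤ (B \ L).card)
      (Nat.cast_nonneg (B ∩ L).card)
      (by rw [hpartR]; exact_mod_cast card_finset_fin_le B) hq1 hX hY
    have hsum : ∑ i ∈ B ∩ L, p i + ∑ i ∈ B \ L, p i = ∑ i ∈ B, p i :=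
      sum_inter_add_sum_sdiff B L p
    rw [hpartR, hsum] at hgap
    have hbucket : rcostBucket (B ∩ L).card B p 0 ≤ ∑ i ∈ B \ L, p i := by
      refine (rcostBucket_le p 0 inter_subset_left rfl).trans_eq ?_
      rw [sdiff_inter_self_left]
      exact sum_congr rfl fun i _ => by rw [sub_zero, abs_of_nonneg (hp0 i)]
    have hmean : 0 ≤ meanIdx p B := div_nonneg (sum_nonneg fun i _ => hp0 i) (Nat.cast_nonneg _)
    have herrB := (single_le_sum (fun j _ => abs_nonneg _) (mem_univ j)).trans
      (herr 0 (fun j => (Bl j ∩ L).card) (fun j => card_le_card inter_subset_left)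
        ((sum_card_inter_of_partition hdisj hBcover L).trans hLm))
    rw [← hB, sub_zero, abs_of_nonneg hmean, ← hpartR, add_sub_cancel_right] at herrB
    have hlow := (neg_le_abs _).trans herrB
    have hnpos : (1 : ℝ) < n := by exact_mod_cast hn
    have hup : ε * rcostIdx m p 0 < n - 1 :=
      (mul_le_mul_of_nonneg_left hcost hε0.le).trans_lt
        (mul_lt_of_lt_one_left (by linarith) hε1)
    unfold meanIdx at hlow
    linarith
  refine ⟨hsingle, ?_⟩
  choose f hf using hBcover
  rw [← hout, ← Fintype.card_fin T]
  refine card_le_card_of_injOn f (fun _ _ => mem_univ _) fun i₁ h₁ i₂ _ h => ?_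
  have hi₁ : n - m < i₁.1 + 1 := by simpa using h₁
  exact card_le_one.1 (hsingle (f i₁) ⟨i₁, hf i₁, hi₁⟩).le _ (hf i₁) _ (h ▸ hf i₂)
end

section
/- Let P be a finite set of n real numbers, let 1 ≤ m < n be an integer, and let ε ∈ (0,1). Let c* ∈ ℝ satisfy cost^(m)(P,c*) ≤ cost^(m)(P,c) for all c ∈ ℝ, let P_I^* ⊆ P with |P_I^*| = n − m attain cost^(m)(P,c*) (i.e. Σ_{p∈P_I^*}|p − c*| = cost^(m)(P,c*)), and set r_max := max_{p∈P_I^*} |p − c*|. Then for every center c ∈ ℝ with |c − c*| ≤ (ε/6)·r_max: cost^(m)(P,c) ≤ Σ_{p∈P_I^*} |p − c| ≤ (1 + 2ε/5)·cost^(m)(P,c). -/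
open Finset
open scoped Classical

/-- Robust cost with `m` outliers of a center `c` for a finite set `P ⊂ ℝ`. -/
noncomputable def rcost (m : ℕ) (P : Finset ℝ) (c : ℝ) : ℝ :=
  sInf {y : ℝ | ∃ L : Finset ℝ, L ⊆ P ∧ L.card = m ∧ y = ∑ p ∈ P \ L, |p - c|}

theorem rcost_le_sum {m : ℕ} {P T : Finset ℝ} (hT : T ⊆ P) (hcard : T.card + m = P.card) (c : ℝ) :
    rcost m P c ≤ ∑ p ∈ T, |p - c| := by
  refine csInf_le ⟨0, ?_⟩ ⟨P \ T, sdiff_subset, ?_, ?_⟩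
  · rintro y ⟨L, -, -, rfl⟩
    exact sum_nonneg fun p _ => abs_nonneg _
  · rw [card_sdiff_of_subset hT]
    omega
  · rw [Finset.sdiff_sdiff_eq_self hT]

theorem le_rcost {m : ℕ} {P : Finset ℝ} (hm : m ≤ P.card) {c a : ℝ}
    (h : ∀ T ⊆ P, T.card + m = P.card → a ≤ ∑ p ∈ T, |p - c|) : a ≤ rcost m P c := by
  obtain ⟨L, hL, hLm⟩ := exists_subset_card_eq hm
  refine le_csInf ⟨_, L, hL, hLm, rfl⟩ ?_
  rintro y ⟨L, hL, hLm, rfl⟩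
  refine h _ sdiff_subset ?_
  rw [← hLm, card_sdiff_add_card_eq_card hL]

/-- A set of points attaining the robust cost of `c` consists of points closest to `c`. -/
theorem abs_sub_le_of_attains_rcost {m : ℕ} {P S : Finset ℝ} {c p q : ℝ} (hS : S ⊆ P)
    (hcard : S.card + m = P.card) (hattain : (∑ x ∈ S, |x - c|) = rcost m P c)
    (hp : p ∈ S) (hqP : q ∈ P) (hqS : q ∉ S) : |p - c| ≤ |q - c| := by
  have hq : q ∉ S.erase p := fun h => hqS (mem_of_mem_erase h)
  have hsub : insert q (S.erase p) ⊆ P := insert_subset hqP ((erase_subset _ _).trans hS)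
  have hswap : (insert q (S.erase p)).card + m = P.card := by
    rw [card_insert_of_notMem hq, card_erase_add_one hp, hcard]
  have hle := rcost_le_sum hsub hswap c
  rw [sum_insert hq, ← hattain, ← add_sum_erase S (fun x => |x - c|) hp] at hle
  linarith

/-- **Robust cost vs. optimal-inlier cost for centers near the optimum
(Case 2 of Lemma `error_alg1_inlier`).** Let `c*` be an optimal robust center
of `P`, let `P_I^*` attain `cost^(m)(P, c*)` with
`r_max = max_{p ∈ P_I^*} |p - c*|`. Then every center `c` with
`|c - c*| ≤ (ε/6)·r_max` satisfies
`cost^(m)(P, c) ≤ Σ_{p∈P_I^*} |p - c| ≤ (1 + 2ε/5)·cost^(m)(P, c)`. -/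
theorem near_optimal_center_cost_bounds
    (P : Finset ℝ) (n m : ℕ) (hP : P.card = n) (hm : 1 ≤ m) (hmn : m < n)
    (ε : ℝ) (hε0 : 0 < ε) (hε1 : ε < 1)
    (cstar : ℝ) (hopt : ∀ c : ℝ, rcost m P cstar ≤ rcost m P c)
    (PIs : Finset ℝ) (hsub : PIs ⊆ P) (hcard : PIs.card = n - m)
    (hattain : (∑ p ∈ PIs, |p - cstar|) = rcost m P cstar)
    (rmax : ℝ)
    (hrmax_ub : ∀ p ∈ PIs, |p - cstar| ≤ rmax)
    (hrmax_mem : ∃ p ∈ PIs, |p - cstar| = rmax)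
    (c : ℝ) (hc : |c - cstar| ≤ ε / 6 * rmax) :
    rcost m P c ≤ (∑ p ∈ PIs, |p - c|) ∧
      (∑ p ∈ PIs, |p - c|) ≤ (1 + 2 * ε / 5) * rcost m P c := by
  have hSm : PIs.card + m = P.card := by omega
  refine ⟨rcost_le_sum hsub hSm c, ?_⟩
  have hfac : 0 < 1 + 2 * ε / 5 := by positivity
  rw [← div_le_iff₀' hfac]
  refine le_rcost (by omega) fun T hT hTm => ?_
  rw [div_le_iff₀' hfac]
  obtain ⟨p₀, hp₀, hp₀r⟩ := hrmax_mem
  have hr : 0 ≤ rmax := hp₀r ▸ abs_nonneg _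
  have hfar : ∀ q ∈ T \ PIs, rmax - |c - cstar| ≤ |q - c| := fun q hq => by
    rw [mem_sdiff] at hq
    have := abs_sub_le_of_attains_rcost hsub hSm hattain hp₀ (hT hq.1) hq.2
    have := abs_sub_le q c cstar
    linarith
  have hnear : ∀ p ∈ PIs \ T, |p - c| ≤ rmax + |c - cstar| := fun p hp => by
    have := hrmax_ub p (mem_sdiff.mp hp).1
    have := abs_sub_le p cstar c
    rw [abs_sub_comm cstar c] at this
    linarith
  have hX := sum_le_card_nsmul _ _ _ hnear
  have hY := card_nsmul_le_sum _ _ _ hfar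
  rw [nsmul_eq_mul] at hX hY
  rw [card_sdiff_comm (by omega : T.card = PIs.card)] at hY
  have hratio : rmax + |c - cstar| ≤ (1 + 2 * ε / 5) * (rmax - |c - cstar|) := by
    nlinarith [mul_nonneg (mul_nonneg hε0.le (sub_nonneg.mpr hε1.le)) hr]
  have hI : 0 ≤ ∑ p ∈ PIs ∩ T, |p - c| := sum_nonneg fun p _ => abs_nonneg _
  have hXY : ∑ p ∈ PIs \ T, |p - c| ≤ (1 + 2 * ε / 5) * ∑ p ∈ T \ PIs, |p - c| := by
    calc ∑ p ∈ PIs \ T, |p - c| ≤ (PIs \ T).card * (rmax + |c - cstar|) := hX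
      _ ≤ (PIs \ T).card * ((1 + 2 * ε / 5) * (rmax - |c - cstar|)) := by gcongr
      _ = (1 + 2 * ε / 5) * ((PIs \ T).card * (rmax - |c - cstar|)) := by ring
      _ ≤ _ := by gcongr
  rw [← sum_inter_add_sum_sdiff PIs T, ← sum_inter_add_sum_sdiff T PIs, inter_comm T PIs]
  nlinarith [mul_nonneg hε0.le hI]
end
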